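/- Let Lₖ denote the Lucas numbers with L₁ = 1, L₂ = 3, and let n > 3. Then det(circ(L₁, L₂, …, Lₙ)) = (1 - L_{n+1})^{n-1} + (Lₙ - 2)^{n-2} · Σ_{k=1}^{n-1} (L_{k+2} - 3L_{k+1}) · ((1 - L_{n+1})/(Lₙ - 2))^{k-1}. -/

import Mathlib

/-- The matrix `a • 1 - b • P`, where `P` is the cyclic shift matrix. -/
def cyclicBidiagonal {R : Type*} [CommRing R] (m : ℕ) (a b : R) :
    Matrix (Fin (m + 2)) (Fin (m + 2)) R :=
  Matrix.of fun i j => (if j = i then a else 0) - if j = i + 1 then b else 0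

theorem det_cyclicBidiagonal {R : Type*} [CommRing R] (m : ℕ) (a b : R) :
    (cyclicBidiagonal m a b).det = a ^ (m + 2) - b ^ (m + 2) := by
  have h_succ : ∀ i j : Fin (m + 1), j.succ = i.castSucc + 1 ↔ j = i := by
    intro i j
    rw [Fin.coeSucc_eq_succ, Fin.succ_inj]
  have h_zero : ∀ i : Fin (m + 2), 0 = i + 1 ↔ i = Fin.last (m + 1) := by
    intro i
    rw [eq_comm, Fin.ext_iff, Fin.val_add_one]
    split_ifs with h <;> simp [h]
  have h_first : ((cyclicBidiagonal m a b).submatrix (Fin.succAbove 0) Fin.succ).det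
      = a ^ (m + 1) := by
    rw [Matrix.det_of_isUpperTriangular]
    · simp [cyclicBidiagonal]
    · intro i j hij
      simp only [id_eq] at hij
      simp only [cyclicBidiagonal, Matrix.submatrix_apply, Matrix.of_apply,
        Fin.zero_succAbove, Fin.succ_inj]
      have h1 : j ≠ i := hij.ne
      have h2 : j.succ ≠ i.succ + 1 := by
        intro h
        have := congrArg Fin.val h
        rw [Fin.val_add_one] at this
        have hlt : j.val < i.val := hij
        split_ifs at this <;> simp at this; omega
      simp [h1, h2]
  have h_last : ((cyclicBidiagonal m a b).submatrix (Fin.succAbove (Fin.last (m + 1)))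
      Fin.succ).det = (-b) ^ (m + 1) := by
    rw [Matrix.det_of_isLowerTriangular]
    · have h : ∀ i : Fin (m + 1), i.succ ≠ i.castSucc := fun i => i.castSucc_lt_succ.ne'
      simp [cyclicBidiagonal, h]
    · intro i j hij
      have hij' : i < j := hij
      have h1 : j ≠ i := hij'.ne'
      have h2 : j.succ ≠ i.castSucc := by
        intro h
        have := congrArg Fin.val h
        have hlt : i.val < j.val := hij
        simp at this; omega
      simp only [cyclicBidiagonal, Matrix.submatrix_apply, Matrix.of_apply,
        Fin.succAbove_last, h_succ]
      simp [h1, h2]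
  rw [Matrix.det_succ_column_zero, Finset.sum_eq_add (0 : Fin (m + 2)) (Fin.last (m + 1))]
  · rw [h_first, h_last]
    simp only [cyclicBidiagonal, Matrix.of_apply, h_zero]
    have h0 : (0 : Fin (m + 2)) ≠ Fin.last (m + 1) := (Fin.last_pos).ne
    simp only [h0, if_true, if_false, Fin.val_last, Fin.val_zero, neg_pow b]
    have : ((-1 : R) ^ (m + 1)) * (-1) ^ (m + 1) = 1 := by
      rw [← mul_pow]; simp
    linear_combination (-b ^ (m + 2)) * this
  · exact (Fin.last_pos).ne
  · rintro i - ⟨hi0, hil⟩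
    simp [cyclicBidiagonal, h_zero, hil, hi0.symm]
  · simp
  · simp

theorem mul_cyclicBidiagonal_apply {R : Type*} [CommRing R] (m : ℕ) (a b : R)
    (A : Matrix (Fin (m + 2)) (Fin (m + 2)) R) (i j : Fin (m + 2)) :
    (A * cyclicBidiagonal m a b) i j = a * A i j - b * A i (j - 1) := by
  have h : ∀ k : Fin (m + 2), j = k + 1 ↔ j - 1 = k := fun k => sub_eq_iff_eq_add.symm
  simp only [Matrix.mul_apply, cyclicBidiagonal, Matrix.of_apply, h, mul_sub,
    Finset.sum_sub_distrib, mul_ite, mul_zero, Finset.sum_ite_eq, Finset.mem_univ, if_true]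
  ring

/-- A circulant matrix whose entries satisfy `L (k + 2) = L (k + 1) + L k`, multiplied by
`1 - P - P ^ 2`, is bidiagonal. -/
theorem circulant_mul_cyclicBidiagonal {L : ℕ → ℝ} (hrec : ∀ k, L (k + 3) = L (k + 2) + L (k + 1))
    (m : ℕ) {p q : ℝ} (hadd : p + q = 1) (hmul : p * q = -1) :
    (Matrix.of fun i j : Fin (m + 2) => L ((j - i : Fin (m + 2)).val + 1)) *
        cyclicBidiagonal m 1 p * cyclicBidiagonal m 1 q =
      cyclicBidiagonal m (L 1 - L (m + 3)) (L (m + 2) + L 1 - L 2) := by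
  ext i j
  have key : ∀ k : Fin (m + 2),
      L (k.val + 1) - L ((k - 1).val + 1) - L ((k - 1 - 1).val + 1) =
      (if k = 0 then L 1 - L (m + 3) else 0) -
        if k = 1 then L (m + 2) + L 1 - L 2 else 0 := by
    intro k
    have h0 : (0 - 1 : Fin (m + 2)).val = m + 1 := by simp
    have hs : ∀ t (ht : t + 1 < m + 2), (⟨t + 1, ht⟩ - 1 : Fin (m + 2)) = ⟨t, by omega⟩ := by
      intro t ht
      rw [sub_eq_iff_eq_add]
      ext
      simp [Fin.val_add, Nat.mod_eq_of_lt ht]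
    have hl : (0 - 1 : Fin (m + 2)) = ⟨m + 1, by omega⟩ := Fin.ext h0
    obtain ⟨k, hk⟩ := k
    match k, hk with
    | 0, hk =>
      have e : (⟨0, hk⟩ : Fin (m + 2)) = 0 := rfl
      rw [e, hl, hs m]
      have := hrec m
      simp only [if_true, Fin.val_zero, zero_ne_one, if_false]
      rw [this]; ring_nf
    | 1, hk =>
      have e : (⟨0, by omega⟩ : Fin (m + 2)) = 0 := rfl
      rw [hs 0, e, hl]
      have e1 : (⟨0 + 1, hk⟩ : Fin (m + 2)) = 1 := rfl
      rw [e1]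
      simp; ring
    | t + 2, hk =>
      rw [hs (t + 1), hs t]
      have e0 : (⟨t + 2, hk⟩ : Fin (m + 2)) ≠ 0 := by simp [Fin.ext_iff]
      have e1 : (⟨t + 2, hk⟩ : Fin (m + 2)) ≠ 1 := by simp [Fin.ext_iff]
      simp only [e0, e1, if_false, hrec]
      ring
  have := key (j - i)
  have c1 : j - i = 0 ↔ j = i := sub_eq_zero
  have c2 : j - i = 1 ↔ j = i + 1 := by rw [sub_eq_iff_eq_add, add_comm i]
  simp only [c1, c2] at this
  simp only [mul_cyclicBidiagonal_apply, Matrix.of_apply]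
  simp only [cyclicBidiagonal, Matrix.of_apply]
  rw [← this, show j - 1 - i = j - i - 1 by abel, show j - 1 - 1 - i = j - i - 1 - 1 by abel]
  linear_combination (-L ((j - i - 1).val + 1)) * hadd + L ((j - i - 1 - 1).val + 1) * hmul

theorem lucas_eq_goldenRatio_pow {L : ℕ → ℝ} (hL1 : L 1 = 1) (hL2 : L 2 = 3)
    (hrec : ∀ k, L (k + 3) = L (k + 2) + L (k + 1)) (k : ℕ) :
    L (k + 1) = Real.goldenRatio ^ (k + 1) + Real.goldenConj ^ (k + 1) := by
  induction k using Nat.twoStepInduction with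
  | zero => simp [hL1, Real.goldenRatio_add_goldenConj]
  | one =>
    simp only [Nat.reduceAdd, Real.goldenRatio_sq, Real.goldenConj_sq, hL2]
    linear_combination -Real.goldenRatio_add_goldenConj
  | more k h1 h2 =>
    rw [hrec k, h1, h2]
    linear_combination (-Real.goldenRatio ^ (k + 1)) * Real.goldenRatio_sq -
      Real.goldenConj ^ (k + 1) * Real.goldenConj_sq

theorem lucas_cassini {L : ℕ → ℝ} (hL1 : L 1 = 1) (hL2 : L 2 = 3)
    (hrec : ∀ k, L (k + 3) = L (k + 2) + L (k + 1)) (k : ℕ) :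
    L (k + 1) ^ 2 + L (k + 1) * L (k + 2) - L (k + 2) ^ 2 = 5 * (-1) ^ (k + 1) := by
  induction k with
  | zero => norm_num [hL1, hL2]
  | succ k ih =>
    rw [hrec k, pow_succ]
    linear_combination -ih

theorem fibonacci_geom_sum {u : ℕ → ℝ} (hrec : ∀ k, u (k + 3) = u (k + 2) + u (k + 1))
    (r : ℝ) (N : ℕ) :
    (1 - r - r ^ 2) * ∑ k ∈ Finset.range (N + 1), u (k + 1) * r ^ k =
      u 1 + (u 2 - u 1) * r - u (N + 2) * r ^ (N + 1) - u (N + 1) * r ^ (N + 2) := by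
  induction N with
  | zero => simp; ring
  | succ N ih =>
    rw [Finset.sum_range_succ, mul_add, ih, hrec N]
    ring

/-- Shen–Cen–Hao: determinant of the circulant matrix of the first `n` Lucas numbers. -/
theorem det_circulant_lucas (n : ℕ) (hn : 3 < n) (L : ℕ → ℝ)
    (hL1 : L 1 = 1) (hL2 : L 2 = 3)
    (hrec : ∀ k, 3 ≤ k → L k = L (k - 1) + L (k - 2)) :
    Matrix.det (Matrix.of fun i j : Fin n => L (((j : ℕ) + n - (i : ℕ)) % n + 1)) =
      (1 - L (n + 1)) ^ (n - 1) +
        (L n - 2) ^ (n - 2) *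
          ∑ k ∈ Finset.Icc 1 (n - 1),
            (L (k + 2) - 3 * L (k + 1)) * ((1 - L (n + 1)) / (L n - 2)) ^ (k - 1) := by
  have hrec' : ∀ k, L (k + 3) = L (k + 2) + L (k + 1) := fun k => hrec (k + 3) (by omega)
  have hge : ∀ k, 4 ≤ L (k + 3) ∧ 3 ≤ L (k + 2) := by
    intro k
    induction k with
    | zero => rw [hrec' 0]; norm_num [hL1, hL2]
    | succ k ih => exact ⟨by rw [hrec' (k + 1)]; linarith, by linarith⟩
  obtain ⟨m, rfl⟩ : ∃ m, n = m + 2 := ⟨n - 2, by omega⟩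
  obtain ⟨t, rfl⟩ : ∃ t, m = t + 1 := ⟨m - 1, by omega⟩
  have hmat : (Matrix.of fun i j : Fin (t + 1 + 2) =>
      L (((j : ℕ) + (t + 1 + 2) - (i : ℕ)) % (t + 1 + 2) + 1)) =
      Matrix.of fun i j : Fin (t + 1 + 2) => L ((j - i : Fin (t + 1 + 2)).val + 1) := by
    ext i j
    simp only [Matrix.of_apply, Fin.val_sub]
    congr 3
    omega
  rw [hmat]
  have hdet := congrArg Matrix.det (circulant_mul_cyclicBidiagonal hrec' (t + 1)
    Real.goldenRatio_add_goldenConj Real.goldenRatio_mul_goldenConj)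
  rw [Matrix.det_mul, Matrix.det_mul] at hdet
  generalize Matrix.det (Matrix.of fun i j : Fin (t + 1 + 2) =>
    L ((j - i : Fin (t + 1 + 2)).val + 1)) = d at *
  rw [det_cyclicBidiagonal, det_cyclicBidiagonal,
    det_cyclicBidiagonal] at hdet
  have hbinet := lucas_eq_goldenRatio_pow hL1 hL2 hrec' (t + 2)
  have hprod : Real.goldenRatio ^ (t + 3) * Real.goldenConj ^ (t + 3) = (-1) ^ (t + 3) := by
    rw [← mul_pow, Real.goldenRatio_mul_goldenConj]
  have hcas := lucas_cassini hL1 hL2 hrec' (t + 2)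
  have hsum := fibonacci_geom_sum (u := fun k => L (k + 2) - 3 * L (k + 1))
    (fun k => by simp only [hrec']; ring) ((1 - L (t + 4)) / (L (t + 3) - 2)) (t + 1)
  have hIcc : ∑ k ∈ Finset.Icc 1 (t + 1 + 2 - 1),
      (L (k + 2) - 3 * L (k + 1)) * ((1 - L (t + 1 + 2 + 1)) / (L (t + 1 + 2) - 2)) ^ (k - 1) =
      ∑ k ∈ Finset.range (t + 1 + 1), (L (k + 1 + 2) - 3 * L (k + 1 + 1)) *
        ((1 - L (t + 4)) / (L (t + 3) - 2)) ^ k := by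
    rw [Finset.sum_bij' (fun k _ => k - 1) (fun k _ => k + 1)] <;>
      intro k hk <;> simp at hk ⊢
    · omega
    · omega
    · omega
    · simp [Nat.sub_add_cancel hk.1]
  rw [hIcc]
  generalize ∑ k ∈ Finset.range (t + 1 + 1), (L (k + 1 + 2) - 3 * L (k + 1 + 1)) *
    ((1 - L (t + 4)) / (L (t + 3) - 2)) ^ k = S at hsum ⊢
  have hL3 : L 3 = 4 := by rw [hrec' 0]; norm_num [hL1, hL2]
  have hL4 : L 4 = 7 := by rw [hrec' 1]; norm_num [hL2, hL3]
  have hL5 : L (t + 5) = L (t + 4) + L (t + 3) := hrec' (t + 2)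
  have hy := (hge t).1
  simp only [add_assoc, Nat.reduceAdd, hL1, hL2, hL3, hL4, hL5,
    one_pow] at hdet hbinet hcas hsum ⊢
  simp only [show t + 3 - 1 = t + 2 from rfl, show t + 3 - 2 = t + 1 from rfl]
  generalize L (t + 3) = N at *
  generalize L (t + 4) = M at *
  have hN : N - 2 ≠ 0 := by linarith
  generalize hr : (1 - M) / (N - 2) = r at *
  have hx : 1 - M = r * (N - 2) := by rw [← hr, div_mul_cancel₀ _ hN]
  have hpow : ∀ k, (1 - M) ^ k = r ^ k * (N - 2) ^ k := fun k => by rw [hx, mul_pow]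
  have hq : (N - 2) ^ 2 - (1 - M) * (N - 2) - (1 - M) ^ 2 = 5 * (1 - N + (-1) ^ (t + 3)) := by
    linear_combination hcas
  have hd : d * (1 - N + (-1) ^ (t + 3)) = (1 - M) ^ (t + 3) - (N - 2) ^ (t + 3) := by
    rw [show N - 2 = N + 1 - 3 by ring, ← hdet]
    linear_combination -d * hbinet - d * hprod
  have hD : 1 - N + (-1) ^ (t + 3) ≠ 0 := by
    rcases neg_one_pow_eq_or ℝ (t + 3) with h | h <;> rw [h] <;> intro h' <;> linarith
  have hS : ((N - 2) ^ 2 - (1 - M) * (N - 2) - (1 - M) ^ 2) * ((N - 2) ^ (t + 1) * S) =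
      -5 * (N - 2) ^ (t + 3) - (N - 2 * M) * (1 - M) ^ (t + 2) * (N - 2) -
        (M - 3 * N) * (1 - M) ^ (t + 3) := by
    rw [hpow (t + 2), hpow (t + 3), hx]
    linear_combination (N - 2) ^ (t + 3) * hsum
  apply mul_left_cancel₀ (mul_ne_zero (by norm_num : (5 : ℝ) ≠ 0) hD)
  linear_combination 5 * hd - hS + ((1 - M) ^ (t + 2) + (N - 2) ^ (t + 1) * S) * hq
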